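/- arXiv:2206.01468 — 2 statements merged into one kernel-verified Lean document; each statement's English description precedes it below -/
import Mathlib

section
/- Fix real numbers q, a, b, c, d with b ≥ 0 and d ≥ 0, and define for n > 0 the functions p_a(n) = ((1/2)·n·q + a)/((1/2)·n + b) and p_b(n) = ((1/2)·n·q + c)/((1/2)·n + d). Then, as n → ∞, p_a(n) → q, p_b(n) → q, and p_a(n) - p_b(n) → 0. In particular, in each of the four events E1–E4 of the heterogeneous model, if the numbers J_F of fundamentalists and J_S of speculators and their quotes q^F, q^S are held bounded while the number J_N of noise traders tends to infinity, the prevailing bid and ask prices both converge to the noise traders' quote q, so the market becomes an equilibrium and the heterogeneous average market-clearing price converges to the homogeneous equilibrium market-clearing price q. -/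
open Filter Topology

/-- The ratio `((n/2)·q + a)/(n/2 + b)` equals `q + (a - b·q)/(n/2 + b)` for large `n`, hence
tends to `q`. -/
theorem tendsto_half_mul_add_div_half_mul_add (q a b : ℝ) :
    Tendsto (fun n : ℝ => ((1 / 2) * n * q + a) / ((1 / 2) * n + b)) atTop (𝓝 q) := by
  have hden : Tendsto (fun n : ℝ => (1 / 2) * n + b) atTop atTop :=
    tendsto_atTop_add_const_right _ b (tendsto_id.const_mul_atTop (by norm_num))
  have hlim : Tendsto (fun n : ℝ => q + (a - b * q) / ((1 / 2) * n + b)) atTop (𝓝 q) := by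
    simpa using (hden.const_div_atTop (a - b * q)).const_add q
  refine hlim.congr' ?_
  filter_upwards [hden.eventually_ne_atTop 0] with n hn
  rw [eq_div_iff hn, add_mul, div_mul_cancel₀ _ hn]
  ring

/-- Proposition 2: with `p_a(n) = ((n/2)·q + a)/(n/2 + b)` and
`p_b(n) = ((n/2)·q + c)/(n/2 + d)` (`b, d ≥ 0`), as the number `n` of noise traders
tends to infinity, `p_a(n) → q`, `p_b(n) → q` and the spread `p_a(n) - p_b(n) → 0`:
the heterogeneous average market-clearing price converges to the homogeneous
equilibrium market-clearing price `q`. -/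
theorem stmt3 (q a b c d : ℝ) (hb : 0 ≤ b) (hd : 0 ≤ d) :
    Tendsto (fun n : ℝ => ((1 / 2) * n * q + a) / ((1 / 2) * n + b)) atTop (𝓝 q) ∧
    Tendsto (fun n : ℝ => ((1 / 2) * n * q + c) / ((1 / 2) * n + d)) atTop (𝓝 q) ∧
    Tendsto (fun n : ℝ =>
        ((1 / 2) * n * q + a) / ((1 / 2) * n + b)
          - ((1 / 2) * n * q + c) / ((1 / 2) * n + d)) atTop (𝓝 0) := by
  have hask := tendsto_half_mul_add_div_half_mul_add q a b
  have hbid := tendsto_half_mul_add_div_half_mul_add q c d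
  exact ⟨hask, hbid, by simpa only [sub_self] using hask.sub hbid⟩
end

section
/- Let κ > 1, α ∈ (0,1), and F > 0, and let Agents be a nonempty finite index set. Suppose (p̄_t)_{t ≥ 0} and, for each agent j, (q_t^j)_{t ≥ 1} and (u_t^j)_{t ≥ 1} are real sequences such that p̄_0 = F, for every t ≥ 1 and every agent j one has 0 ≤ u_t^j ≤ κ·F and q_t^j = (1-α)·u_t^j + α·p̄_{t-1}, and for every t ≥ 1 one has p̄_t ≤ max over agents j of q_t^j. Then q_t^j < κ·F for every t ≥ 1 and every agent j. -/
/-- The key inductive bound in Lemma 1 of the paper: if `p̄ 0 = F`, each quote is the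
convex combination `q t j = (1-α)·u t j + α·p̄ (t-1)` with `0 ≤ u t j ≤ κ·F`, and the
mean traded price never exceeds the maximal quote, then every quote stays strictly
below `κ·F`. -/
theorem stmt7 {Agents : Type*} [Fintype Agents] [Nonempty Agents]
    (κ α F : ℝ) (hκ : 1 < κ) (hα0 : 0 < α) (hα1 : α < 1) (hF : 0 < F)
    (pbar : ℕ → ℝ) (q u : ℕ → Agents → ℝ)
    (hp0 : pbar 0 = F)
    (hu : ∀ t, 1 ≤ t → ∀ j, 0 ≤ u t j ∧ u t j ≤ κ * F)
    (hq : ∀ t, 1 ≤ t → ∀ j, q t j = (1 - α) * u t j + α * pbar (t - 1))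
    (hpmax : ∀ t, 1 ≤ t → pbar t ≤ ⨆ j, q t j) :
    ∀ t, 1 ≤ t → ∀ j, q t j < κ * F := by
  have quote_lt : ∀ n, pbar n < κ * F → ∀ j, q (n + 1) j < κ * F := by
    intro n hn j
    rw [hq (n + 1) n.succ_pos j, Nat.add_sub_cancel]
    have h1 := mul_le_mul_of_nonneg_left (hu (n + 1) n.succ_pos j).2 (sub_nonneg.2 hα1.le)
    have h2 := mul_lt_mul_of_pos_left hn hα0
    linarith
  have price_lt : ∀ n, pbar n < κ * F := by
    intro n
    induction n with
    | zero => rw [hp0]; exact lt_mul_of_one_lt_left hF hκ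
    | succ n ih =>
      obtain ⟨j, hj⟩ := exists_eq_ciSup_of_finite (f := q (n + 1))
      exact (hpmax (n + 1) n.succ_pos).trans_lt (hj ▸ quote_lt n ih j)
  intro t ht j
  obtain ⟨n, rfl⟩ := Nat.exists_eq_add_of_le' ht
  exact quote_lt n (price_lt n) j
end
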